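/- Uniform control of the lower-order (L²) norm: for every R > 0 there exists a constant C > 0, depending only on α, m and R, such that every classical solution u of the degenerately damped wave equation on [0,T] with zero initial velocity ∂ₜu(0,·) ≡ 0 and initial energy E_u(0) ≤ R satisfies ∫₀¹ u(t,x)² dx ≤ C ∫₀¹ u(0,x)² dx for all t ∈ [0,T]. -/

import Mathlib

open MeasureTheory Real Set

/-- The partial derivative in time of a function `u(t,x)`. -/
noncomputable def pdt (u : ℝ → ℝ → ℝ) : ℝ → ℝ → ℝ := fun t x => deriv (fun s => u s x) t

/-- The partial derivative in space of a function `u(t,x)`. -/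
noncomputable def pdx (u : ℝ → ℝ → ℝ) : ℝ → ℝ → ℝ := fun t x => deriv (fun y => u t y) x

/-- A classical (C²) solution of the degenerately damped wave equation
`∂ₜ²u - ∂ₓ²u + α u^(2m) ∂ₜu = 0` on `[0,T] × [0,1]` with homogeneous Dirichlet
boundary conditions. -/
def IsClassicalSolution (α : ℝ) (m : ℕ) (T : ℝ) (u : ℝ → ℝ → ℝ) : Prop :=
  ContDiff ℝ 2 (Function.uncurry u) ∧
  (∀ t ∈ Icc (0:ℝ) T, ∀ x ∈ Icc (0:ℝ) 1,
    pdt (pdt u) t x - pdx (pdx u) t x + α * (u t x) ^ (2*m) * pdt u t x = 0) ∧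
  (∀ t ∈ Icc (0:ℝ) T, u t 0 = 0 ∧ u t 1 = 0)

/-- The energy `E_u(t) = ½∫₀¹ (∂ₓu)² + ½∫₀¹ (∂ₜu)²`. -/
noncomputable def energy (u : ℝ → ℝ → ℝ) (t : ℝ) : ℝ :=
  (1/2) * (∫ x in (0:ℝ)..1, (pdx u t x)^2) + (1/2) * (∫ x in (0:ℝ)..1, (pdt u t x)^2)

theorem integral_swap_of_continuous {f : ℝ → ℝ → ℝ} (hf : Continuous (Function.uncurry f))
    (a b c d : ℝ) :
    ∫ x in a..b, ∫ y in c..d, f x y = ∫ y in c..d, ∫ x in a..b, f x y := by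
  apply MeasureTheory.intervalIntegral_intervalIntegral_swap
  exact (hf.continuousOn.integrableOn_compact
    (isCompact_uIcc.prod isCompact_uIcc)).mono_set
      (prod_mono uIoc_subset_uIcc uIoc_subset_uIcc)

theorem hasDerivAt_integral_of_continuous_deriv {f g : ℝ → ℝ → ℝ}
    (hf : Continuous (Function.uncurry f)) (hg : Continuous (Function.uncurry g))
    (hfg : ∀ s x, HasDerivAt (fun y => f s y) (g s x) x) (t x : ℝ) :
    HasDerivAt (fun y => ∫ s in (0:ℝ)..t, f s y) (∫ s in (0:ℝ)..t, g s x) x := by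
  have hG : Continuous (fun y => ∫ s in (0:ℝ)..t, g s y) :=
    intervalIntegral.continuous_parametric_intervalIntegral_of_continuous'
      (f := fun y s => g s y) (hg.comp continuous_swap) 0 t
  have hprim : (fun y => ∫ s in (0:ℝ)..t, f s y) =
      fun y => (∫ s in (0:ℝ)..t, f s 0) + ∫ z in (0:ℝ)..y, ∫ s in (0:ℝ)..t, g s z := by
    funext y
    rw [← integral_swap_of_continuous hg, ← intervalIntegral.integral_add]
    · refine intervalIntegral.integral_congr fun s _ => ?_
      have hgs : Continuous (g s) := hg.comp (Continuous.prodMk_right s)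
      have := intervalIntegral.integral_eq_sub_of_hasDerivAt (a := 0) (b := y)
        (fun z _ => hfg s z) (hgs.intervalIntegrable _ _)
      simp only [this]
      ring
    · exact (hf.comp (Continuous.prodMk_left 0)).intervalIntegrable _ _
    · exact (intervalIntegral.continuous_parametric_intervalIntegral_of_continuous'
        hg 0 y).intervalIntegrable _ _
  rw [hprim]
  exact (intervalIntegral.integral_hasDerivAt_right (hG.intervalIntegrable _ _)
    (hG.stronglyMeasurableAtFilter _ _) hG.continuousAt).const_add _

theorem hasDerivAt_pdt {u : ℝ → ℝ → ℝ} (hu : Differentiable ℝ (Function.uncurry u)) (t x : ℝ) :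
    HasDerivAt (fun s => u s x) (pdt u t x) t := by
  have : DifferentiableAt ℝ (Function.uncurry u ∘ fun s => (s, x)) t :=
    (hu _).comp t (by fun_prop)
  exact this.hasDerivAt

theorem hasDerivAt_pdx {u : ℝ → ℝ → ℝ} (hu : Differentiable ℝ (Function.uncurry u)) (t x : ℝ) :
    HasDerivAt (fun y => u t y) (pdx u t x) x := by
  have : DifferentiableAt ℝ (Function.uncurry u ∘ fun y => (t, y)) x :=
    (hu _).comp x (by fun_prop)
  exact this.hasDerivAt

theorem uncurry_pdt_eq {u : ℝ → ℝ → ℝ} (hu : Differentiable ℝ (Function.uncurry u)) :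
    Function.uncurry (pdt u) = fun p => fderiv ℝ (Function.uncurry u) p (1, 0) := by
  funext ⟨t, x⟩
  have h : HasDerivAt (fun s : ℝ => (s, x)) (1, 0) t :=
    (hasDerivAt_id t).prodMk (hasDerivAt_const t x)
  have hcomp : HasDerivAt (Function.uncurry u ∘ fun s : ℝ => (s, x))
      (fderiv ℝ (Function.uncurry u) (t, x) (1, 0)) t :=
    (hu (t, x)).hasFDerivAt.comp_hasDerivAt t h
  exact (hasDerivAt_pdt hu t x).unique hcomp

theorem uncurry_pdx_eq {u : ℝ → ℝ → ℝ} (hu : Differentiable ℝ (Function.uncurry u)) :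
    Function.uncurry (pdx u) = fun p => fderiv ℝ (Function.uncurry u) p (0, 1) := by
  funext ⟨t, x⟩
  have h : HasDerivAt (fun y : ℝ => (t, y)) (0, 1) x :=
    (hasDerivAt_const x t).prodMk (hasDerivAt_id x)
  have hcomp : HasDerivAt (Function.uncurry u ∘ fun y : ℝ => (t, y))
      (fderiv ℝ (Function.uncurry u) (t, x) (0, 1)) x :=
    (hu (t, x)).hasFDerivAt.comp_hasDerivAt x h
  exact (hasDerivAt_pdx hu t x).unique hcomp

theorem contDiff_pdt {u : ℝ → ℝ → ℝ} {n : ℕ}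
    (hu : ContDiff ℝ (n + 1) (Function.uncurry u)) :
    ContDiff ℝ n (Function.uncurry (pdt u)) := by
  rw [uncurry_pdt_eq (hu.differentiable (by simp))]
  exact (hu.fderiv_right le_rfl).clm_apply contDiff_const

theorem contDiff_pdx {u : ℝ → ℝ → ℝ} {n : ℕ}
    (hu : ContDiff ℝ (n + 1) (Function.uncurry u)) :
    ContDiff ℝ n (Function.uncurry (pdx u)) := by
  rw [uncurry_pdx_eq (hu.differentiable (by simp))]
  exact (hu.fderiv_right le_rfl).clm_apply contDiff_const

theorem sq_le_integral_deriv_sq {f g : ℝ → ℝ} (hg : Continuous g)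
    (hfg : ∀ x, HasDerivAt f (g x) x) (h0 : f 0 = 0) {x : ℝ} (hx : x ∈ Icc (0:ℝ) 1) :
    f x ^ 2 ≤ ∫ y in (0:ℝ)..1, g y ^ 2 := by
  have hint : ∫ y in (0:ℝ)..x, g y = f x := by
    rw [intervalIntegral.integral_eq_sub_of_hasDerivAt (fun z _ => hfg z)
      (hg.intervalIntegrable _ _), h0, sub_zero]
  have hnonneg : 0 ≤ ∫ y in (0:ℝ)..x, (g y - f x) ^ 2 :=
    intervalIntegral.integral_nonneg hx.1 fun y _ => sq_nonneg _
  have hexp : ∫ y in (0:ℝ)..x, (g y - f x) ^ 2 =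
      (∫ y in (0:ℝ)..x, g y ^ 2) - 2 * f x * f x + f x ^ 2 * x := by
    have h1 : ∀ y, (g y - f x) ^ 2 = g y ^ 2 - 2 * f x * g y + f x ^ 2 := fun y => by ring
    simp only [h1]
    rw [intervalIntegral.integral_add, intervalIntegral.integral_sub,
      intervalIntegral.integral_const_mul, hint, intervalIntegral.integral_const]
    · simp [mul_comm]
    all_goals exact Continuous.intervalIntegrable (by fun_prop) _ _
  have hmono : ∫ y in (0:ℝ)..x, g y ^ 2 ≤ ∫ y in (0:ℝ)..1, g y ^ 2 :=
    intervalIntegral.integral_mono_interval le_rfl hx.1 hx.2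
      (Filter.Eventually.of_forall fun y => sq_nonneg (g y))
      ((hg.pow 2).intervalIntegrable _ _)
  nlinarith [mul_nonneg (sq_nonneg (f x)) (sub_nonneg.2 hx.2)]

theorem IsClassicalSolution.pdt_eq {α : ℝ} {m : ℕ} {T : ℝ} {u : ℝ → ℝ → ℝ}
    (hu : IsClassicalSolution α m T u) (hv : ∀ x ∈ Icc (0:ℝ) 1, pdt u 0 x = 0)
    {t x : ℝ} (ht : t ∈ Icc (0:ℝ) T) (hx : x ∈ Icc (0:ℝ) 1) :
    pdt u t x = (∫ s in (0:ℝ)..t, pdx (pdx u) s x)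
      - α / (2 * m + 1) * u t x ^ (2 * m + 1) + α / (2 * m + 1) * u 0 x ^ (2 * m + 1) := by
  obtain ⟨hC, hpde, -⟩ := hu
  have hCt : ContDiff ℝ 1 (Function.uncurry (pdt u)) := contDiff_pdt (n := 1) hC
  have hCx : ContDiff ℝ 1 (Function.uncurry (pdx u)) := contDiff_pdx (n := 1) hC
  have hutt : Continuous (fun s => pdt (pdt u) s x) :=
    (contDiff_pdt (n := 0) (by simpa using hCt)).continuous.comp (Continuous.prodMk_left x)
  have huxx : Continuous (fun s => pdx (pdx u) s x) :=
    (contDiff_pdx (n := 0) (by simpa using hCx)).continuous.comp (Continuous.prodMk_left x)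
  have hd : ∀ s, HasDerivAt (fun s => pdt u s x + α / (2 * m + 1) * u s x ^ (2 * m + 1))
      (pdt (pdt u) s x + α * u s x ^ (2 * m) * pdt u s x) s := by
    intro s
    refine ((hasDerivAt_pdt (hCt.differentiable one_ne_zero) s x).fun_add
      (((hasDerivAt_pdt (hC.differentiable two_ne_zero) s x).fun_pow (2 * m + 1)).const_mul
        (α / (2 * m + 1)))).congr_deriv ?_
    push_cast
    field_simp
  have hcu : Continuous (fun s => u s x) := hC.continuous.comp (Continuous.prodMk_left x)
  have hcut : Continuous (fun s => pdt u s x) := hCt.continuous.comp (Continuous.prodMk_left x)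
  have hftc := intervalIntegral.integral_eq_sub_of_hasDerivAt (a := 0) (b := t)
    (fun s _ => hd s) (Continuous.intervalIntegrable (by fun_prop) _ _)
  have hcongr : ∫ s in (0:ℝ)..t, (pdt (pdt u) s x + α * u s x ^ (2 * m) * pdt u s x)
      = ∫ s in (0:ℝ)..t, pdx (pdx u) s x := by
    refine intervalIntegral.integral_congr fun s hs => ?_
    rw [uIcc_of_le ht.1] at hs
    have := hpde s ⟨hs.1, hs.2.trans ht.2⟩ x hx
    linarith
  rw [hcongr, hv x hx] at hftc
  linarith

/-- With `v = ∫₀ᵗ ∂ₓu`, the time-integrated equation tested against `u`. -/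
theorem IsClassicalSolution.integral_flux_le {α : ℝ} (hα : 0 < α) {m : ℕ} {T : ℝ}
    {u : ℝ → ℝ → ℝ}
    (hu : IsClassicalSolution α m T u) (hv : ∀ x ∈ Icc (0:ℝ) 1, pdt u 0 x = 0)
    {t : ℝ} (ht : t ∈ Icc (0:ℝ) T) :
    ∫ x in (0:ℝ)..1, (2 * u t x * pdt u t x + 2 * (∫ s in (0:ℝ)..t, pdx u s x) * pdx u t x)
      ≤ ∫ x in (0:ℝ)..1, 2 * (α / (2 * m + 1) * u 0 x ^ (2 * m + 1)) * u t x := by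
  have hC := hu.1
  have hCt : ContDiff ℝ 1 (Function.uncurry (pdt u)) := contDiff_pdt (n := 1) hC
  have hCx : ContDiff ℝ 1 (Function.uncurry (pdx u)) := contDiff_pdx (n := 1) hC
  have huxx : Continuous (Function.uncurry (pdx (pdx u))) :=
    (contDiff_pdx (n := 0) (by simpa using hCx)).continuous
  have hcu : ∀ s, Continuous (fun x => u s x) := fun s =>
    hC.continuous.comp (Continuous.prodMk_right s)
  have hcut : Continuous (fun x => pdt u t x) := hCt.continuous.comp (Continuous.prodMk_right t)
  have hcux : Continuous (fun x => pdx u t x) := hCx.continuous.comp (Continuous.prodMk_right t)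
  have hcv : Continuous (fun x => ∫ s in (0:ℝ)..t, pdx u s x) :=
    intervalIntegral.continuous_parametric_intervalIntegral_of_continuous'
      (f := fun x s => pdx u s x) (hCx.continuous.comp continuous_swap) 0 t
  have hcq : Continuous (fun x => ∫ s in (0:ℝ)..t, pdx (pdx u) s x) :=
    intervalIntegral.continuous_parametric_intervalIntegral_of_continuous'
      (f := fun x s => pdx (pdx u) s x) (huxx.comp continuous_swap) 0 t
  have hd : ∀ x, HasDerivAt (fun x => 2 * (u t x * ∫ s in (0:ℝ)..t, pdx u s x))
      (2 * (pdx u t x * (∫ s in (0:ℝ)..t, pdx u s x)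
        + u t x * ∫ s in (0:ℝ)..t, pdx (pdx u) s x)) x := fun x =>
    ((hasDerivAt_pdx (hC.differentiable two_ne_zero) t x).mul
      (hasDerivAt_integral_of_continuous_deriv hCx.continuous huxx
        (hasDerivAt_pdx (hCx.differentiable one_ne_zero)) t x)).const_mul 2
  have hftc := intervalIntegral.integral_eq_sub_of_hasDerivAt (a := 0) (b := 1)
    (fun s _ => hd s) (Continuous.intervalIntegrable (by fun_prop) _ _)
  obtain ⟨h0, h1⟩ := hu.2.2 t ht
  rw [h0, h1] at hftc
  simp only [zero_mul, mul_zero, sub_zero] at hftc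
  have hcu0 := hcu 0
  have hcut' := hcu t
  rw [← sub_nonneg]
  refine le_of_le_of_eq ?_ ((congrArg _ hftc).trans (add_zero _))
  rw [← intervalIntegral.integral_sub, ← intervalIntegral.integral_add]
  · refine intervalIntegral.integral_nonneg zero_le_one fun x hx => ?_
    rw [hu.pdt_eq hv ht hx]
    have : 0 ≤ 2 * (α / (2 * m + 1)) * (u t x ^ (m + 1)) ^ 2 := by positivity
    convert this using 1
    ring
  all_goals exact Continuous.intervalIntegrable (by fun_prop) _ _

/-- The `L²` estimate in which the source is the initial damping potential. -/
theorem IsClassicalSolution.integral_sq_le {α : ℝ} (hα : 0 < α) {m : ℕ} {T : ℝ}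
    {u : ℝ → ℝ → ℝ}
    (hu : IsClassicalSolution α m T u) (hv : ∀ x ∈ Icc (0:ℝ) 1, pdt u 0 x = 0)
    {t : ℝ} (ht : t ∈ Icc (0:ℝ) T) :
    ∫ x in (0:ℝ)..1, u t x ^ 2
      ≤ (∫ x in (0:ℝ)..1, u 0 x ^ 2)
        + ∫ x in (0:ℝ)..1, (α / (2 * m + 1) * u 0 x ^ (2 * m + 1)) ^ 2 := by
  have hC := hu.1
  have hCt : ContDiff ℝ 1 (Function.uncurry (pdt u)) := contDiff_pdt (n := 1) hC
  have hCx : ContDiff ℝ 1 (Function.uncurry (pdx u)) := contDiff_pdx (n := 1) hC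
  set v : ℝ → ℝ → ℝ := fun t x => ∫ s in (0:ℝ)..t, pdx u s x with hvdef
  set w : ℝ → ℝ := fun x => ∫ s in (0:ℝ)..t, u s x with hwdef
  set F : ℝ → ℝ := fun x => α / (2 * m + 1) * u 0 x ^ (2 * m + 1) with hFdef
  have hcu : Continuous (fun p : ℝ × ℝ => u p.1 p.2) := hC.continuous
  have hcut : Continuous (fun p : ℝ × ℝ => pdt u p.1 p.2) := hCt.continuous
  have hcux : Continuous (fun p : ℝ × ℝ => pdx u p.1 p.2) := hCx.continuous
  have hcv : Continuous (fun p : ℝ × ℝ => v p.1 p.2) :=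
    (intervalIntegral.continuous_parametric_primitive_of_continuous (a₀ := 0)
      (f := fun x s => pdx u s x) (μ := volume)
      (hCx.continuous.comp continuous_swap)).comp continuous_swap
  have hcF : Continuous F := by
    have : Continuous (fun x => u 0 x) := hcu.comp (Continuous.prodMk_right 0)
    fun_prop
  have hcw : Continuous w :=
    intervalIntegral.continuous_parametric_intervalIntegral_of_continuous'
      (f := fun x s => u s x) (hC.continuous.comp continuous_swap) 0 t
  have hcflux : Continuous (Function.uncurry fun s x =>
      2 * u s x * pdt u s x + 2 * v s x * pdx u s x) := by
    simp only [Function.uncurry_def]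
    fun_prop
  have hcsrc : Continuous (Function.uncurry fun s x => 2 * F x * u s x) := by
    simp only [Function.uncurry_def]
    fun_prop
  have hcvt : Continuous (fun x => v t x) := hcv.comp (Continuous.prodMk_right t)
  have hcu' : ∀ s, Continuous (fun x => u s x) := fun s => hcu.comp (Continuous.prodMk_right s)
  have hcut' := hcu' t
  have hcu0' := hcu' 0
  have hpoint : ∀ x, ∫ s in (0:ℝ)..t, (2 * u s x * pdt u s x + 2 * v s x * pdx u s x)
      = u t x ^ 2 + v t x ^ 2 - u 0 x ^ 2 := by
    intro x
    have hcx : Continuous fun s => pdx u s x := hcux.comp (Continuous.prodMk_left x)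
    have hd : ∀ s, HasDerivAt (fun s => u s x ^ 2 + v s x ^ 2)
        (2 * u s x * pdt u s x + 2 * v s x * pdx u s x) s := by
      intro s
      have hvd : HasDerivAt (fun s => v s x) (pdx u s x) s :=
        intervalIntegral.integral_hasDerivAt_right (hcx.intervalIntegrable _ _)
          (hcx.stronglyMeasurableAtFilter _ _) hcx.continuousAt
      simpa using ((hasDerivAt_pdt (hC.differentiable two_ne_zero) s x).fun_pow 2).fun_add
        (hvd.fun_pow 2)
    rw [intervalIntegral.integral_eq_sub_of_hasDerivAt (fun s _ => hd s)
      ((hcflux.comp (Continuous.prodMk_left x)).intervalIntegrable _ _)]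
    simp [hvdef]
  have hle : ∫ s in (0:ℝ)..t, ∫ x in (0:ℝ)..1,
        (2 * u s x * pdt u s x + 2 * v s x * pdx u s x)
      ≤ ∫ s in (0:ℝ)..t, ∫ x in (0:ℝ)..1, 2 * F x * u s x := by
    refine intervalIntegral.integral_mono_on ht.1 ?_ ?_ fun s hs =>
      hu.integral_flux_le hα hv ⟨hs.1, hs.2.trans ht.2⟩
    · exact (intervalIntegral.continuous_parametric_intervalIntegral_of_continuous'
        hcflux 0 1).intervalIntegrable _ _
    · exact (intervalIntegral.continuous_parametric_intervalIntegral_of_continuous'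
        hcsrc 0 1).intervalIntegrable _ _
  rw [integral_swap_of_continuous hcflux, integral_swap_of_continuous hcsrc] at hle
  simp only [hpoint, intervalIntegral.integral_const_mul] at hle
  rw [intervalIntegral.integral_sub, intervalIntegral.integral_add] at hle
  rotate_left
  iterate 4 exact Continuous.intervalIntegrable (by fun_prop) _ _
  have hw0 : w 0 = 0 := by
    have : ∀ s ∈ uIcc 0 t, u s 0 = (fun _ => (0:ℝ)) s := fun s hs => by
      rw [uIcc_of_le ht.1] at hs
      exact (hu.2.2 s ⟨hs.1, hs.2.trans ht.2⟩).1
    simpa using intervalIntegral.integral_congr (μ := volume) this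
  have hwv : ∀ x ∈ Icc (0:ℝ) 1, w x ^ 2 ≤ ∫ y in (0:ℝ)..1, v t y ^ 2 := fun x hx =>
    sq_le_integral_deriv_sq hcvt
      (hasDerivAt_integral_of_continuous_deriv hC.continuous hCx.continuous
        (hasDerivAt_pdx (hC.differentiable two_ne_zero)) t) hw0 hx
  have hsrc : ∫ x in (0:ℝ)..1, 2 * F x * w x
      ≤ ∫ x in (0:ℝ)..1, (F x ^ 2 + ∫ y in (0:ℝ)..1, v t y ^ 2) := by
    refine intervalIntegral.integral_mono_on zero_le_one
      (Continuous.intervalIntegrable (by fun_prop) _ _)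
      (Continuous.intervalIntegrable (by fun_prop) _ _) fun x hx => ?_
    nlinarith [hwv x hx, sq_nonneg (F x - w x)]
  rw [intervalIntegral.integral_add (Continuous.intervalIntegrable (by fun_prop) _ _)
    (Continuous.intervalIntegrable (by fun_prop) _ _)] at hsrc
  simp only [intervalIntegral.integral_const, sub_zero, one_smul] at hsrc
  linarith

/-- Uniform control of the lower-order (L²) norm of solutions with zero initial velocity
in terms of the initial L² norm, with a constant depending only on `α`, `m`, `R`. -/
theorem uniform_L2_control
    (α : ℝ) (hα : 0 < α) (m : ℕ) (hm : 1 ≤ m) (R : ℝ) (hR : 0 < R) :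
    ∃ C : ℝ, 0 < C ∧ ∀ T : ℝ, 0 ≤ T → ∀ u : ℝ → ℝ → ℝ,
      IsClassicalSolution α m T u →
      (∀ x ∈ Icc (0:ℝ) 1, pdt u 0 x = 0) →
      energy u 0 ≤ R →
      ∀ t ∈ Icc (0:ℝ) T,
        (∫ x in (0:ℝ)..1, (u t x)^2) ≤ C * (∫ x in (0:ℝ)..1, (u 0 x)^2) := by
  refine ⟨1 + (α / (2 * m + 1)) ^ 2 * (2 * R) ^ (2 * m), by positivity, ?_⟩
  intro T hT u hu hv hE t ht
  have hC := hu.1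
  have hCx : ContDiff ℝ 1 (Function.uncurry (pdx u)) := contDiff_pdx (n := 1) hC
  have hcu : Continuous (fun x => u 0 x) := hC.continuous.comp (Continuous.prodMk_right 0)
  have hgrad : ∫ x in (0:ℝ)..1, pdx u 0 x ^ 2 ≤ 2 * R := by
    have : 0 ≤ ∫ x in (0:ℝ)..1, pdt u 0 x ^ 2 :=
      intervalIntegral.integral_nonneg zero_le_one fun x _ => sq_nonneg _
    unfold energy at hE
    linarith
  have hsup : ∀ x ∈ Icc (0:ℝ) 1, u 0 x ^ 2 ≤ 2 * R := fun x hx =>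
    (sq_le_integral_deriv_sq (hCx.continuous.comp (Continuous.prodMk_right 0))
      (hasDerivAt_pdx (hC.differentiable two_ne_zero) 0)
      (hu.2.2 0 ⟨le_rfl, hT⟩).1 hx).trans hgrad
  have hF : ∫ x in (0:ℝ)..1, (α / (2 * m + 1) * u 0 x ^ (2 * m + 1)) ^ 2
      ≤ ∫ x in (0:ℝ)..1, (α / (2 * m + 1)) ^ 2 * (2 * R) ^ (2 * m) * u 0 x ^ 2 := by
    refine intervalIntegral.integral_mono_on zero_le_one
      (Continuous.intervalIntegrable (by fun_prop) _ _)
      (Continuous.intervalIntegrable (by fun_prop) _ _) fun x hx => ?_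
    calc (α / (2 * m + 1) * u 0 x ^ (2 * m + 1)) ^ 2
        = (α / (2 * m + 1)) ^ 2 * (u 0 x ^ 2) ^ (2 * m) * u 0 x ^ 2 := by ring
      _ ≤ _ := by
        gcongr
        exact hsup x hx
  rw [intervalIntegral.integral_const_mul] at hF
  linarith [hu.integral_sq_le hα hv ht]
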